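/- Let n ≥ 2 and k ≥ 0 be integers, m ∈ ℤ, s ∈ ℂ, λ ∈ ℂ, and let h : ℝⁿ → ℂ be a nonzero harmonic polynomial homogeneous of degree k. Then the following are equivalent: (i) there exists a twice continuously differentiable ψ : (0,∞) → ℂ, not identically zero, satisfying ρ²ψ''(ρ) + (n−1+2k)ρψ'(ρ) + (4s²ρ⁴ − 2ismρ² − 2λ)ψ(ρ) = 0 for all ρ > 0, such that the function y ↦ ψ(‖y‖)h(y), defined on ℝⁿ ∖ {0}, extends to a smooth function on all of ℝⁿ; (ii) there exists an integer l ≥ 0 with λ = l(2l+2k+n−2). -/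

import Mathlib

noncomputable section

/-- `n`-dimensional Euclidean space. -/
abbrev E (n : ℕ) := EuclideanSpace ℝ (Fin n)

/-- Partial derivative in the `j`-th coordinate direction. -/
noncomputable def pd {n : ℕ} (j : Fin n) (f : E n → ℂ) (y : E n) : ℂ :=
  fderiv ℝ f y (EuclideanSpace.single j 1)

/-- The Laplacian `Δ = ∑ⱼ ∂²/∂yⱼ²`. -/
noncomputable def lap {n : ℕ} (f : E n → ℂ) (y : E n) : ℂ :=
  ∑ j : Fin n, pd j (pd j f) y

/-- `h : ℝⁿ → ℂ` is a harmonic polynomial, homogeneous of degree `k`: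
it is given by a polynomial in the coordinates, `h (t • y) = t^k * h y`,
and `Δ h = 0`. -/
def IsHarmonicHomog {n : ℕ} (k : ℕ) (h : E n → ℂ) : Prop :=
  (∃ p : MvPolynomial (Fin n) ℂ, ∀ y : E n, h y = MvPolynomial.eval (fun j => ((y j : ℝ) : ℂ)) p) ∧
  (∀ (t : ℝ) (y : E n), h (t • y) = (t : ℂ) ^ k * h y) ∧
  (∀ y : E n, lap h y = 0)


open Filter Topology Set

/-- The exponential generating function `∑ aⱼ zʲ / j!`. -/
def egf (a : ℕ → ℂ) (z : ℂ) : ℂ := ∑' j : ℕ, a j * (z ^ j / (j.factorial : ℂ))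

lemma hasSum_of_eq {f g : ℕ → ℂ} {c : ℂ} (hfg : ∀ j, f j = g j) (hg : HasSum g c) :
    HasSum f c :=
  (funext hfg : f = g) ▸ hg

lemma norm_egf_term_le {a : ℕ → ℂ} {D C R : ℝ}
    (ha : ∀ j, ‖a j‖ ≤ D * C ^ j) (j : ℕ) {w : ℂ} (hw : ‖w‖ ≤ R) :
    ‖a j * (w ^ j / (j.factorial : ℂ))‖ ≤ D * ((C * R) ^ j / (j.factorial : ℝ)) := by
  have hD : 0 ≤ D * C ^ j := (norm_nonneg _).trans (ha j)
  rw [norm_mul, norm_div, norm_pow, Complex.norm_natCast, mul_pow, mul_div_assoc, ← mul_assoc]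
  have h2 : ‖w‖ ^ j ≤ R ^ j := pow_le_pow_left₀ (norm_nonneg _) hw j
  have := ha j
  gcongr

lemma hasSum_egf {a : ℕ → ℂ} {D C : ℝ}
    (ha : ∀ j, ‖a j‖ ≤ D * C ^ j) (z : ℂ) :
    HasSum (fun j : ℕ => a j * (z ^ j / (j.factorial : ℂ))) (egf a z) :=
  (Summable.of_norm_bounded ((Real.summable_pow_div_factorial (C * ‖z‖)).mul_left D)
    (fun j => norm_egf_term_le ha j le_rfl)).hasSum

lemma hasDerivAt_egf {a : ℕ → ℂ} {D C : ℝ}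
    (ha : ∀ j, ‖a j‖ ≤ D * C ^ j) (z : ℂ) :
    HasDerivAt (egf a) (egf (fun j => a (j + 1)) z) z := by
  set U : Set ℂ := Metric.ball 0 (‖z‖ + 1)
  have hU : IsOpen U := Metric.isOpen_ball
  have hz : z ∈ U := by simp [U]
  have hu := (Real.summable_pow_div_factorial (C * (‖z‖ + 1))).mul_left D
  have hd : ∀ i : ℕ, DifferentiableOn ℂ (fun w : ℂ => a i * (w ^ i / (i.factorial : ℂ))) U :=
    fun i => by fun_prop
  have hle : ∀ (i : ℕ) (w : ℂ), w ∈ U → ‖a i * (w ^ i / (i.factorial : ℂ))‖ ≤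
      D * ((C * (‖z‖ + 1)) ^ i / (i.factorial : ℝ)) := fun i w hw =>
    norm_egf_term_le ha i (by simpa [U] using (mem_ball_zero_iff.1 hw).le)
  have h1 := Complex.hasSum_deriv_of_summable_norm hu hd hU hle hz
  have h2 := ((Complex.differentiableOn_tsum_of_summable_norm hu hd hU hle).differentiableAt
    (hU.mem_nhds hz)).hasDerivAt
  have h3 : deriv (egf a) z = egf (fun j => a (j + 1)) z := by
    have h4 : ∀ i : ℕ, deriv (fun w : ℂ => a i * (w ^ i / (i.factorial : ℂ))) z =
        a i * (i * z ^ (i - 1) / (i.factorial : ℂ)) := fun i => by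
      simp
    simp_rw [h4] at h1
    have h5 := (hasSum_nat_add_iff' 1).2 h1
    simp only [Finset.range_one, Finset.sum_singleton, Nat.cast_zero, zero_mul, zero_div,
      mul_zero, sub_zero] at h5
    refine h5.unique ?_
    have h6 := hasSum_egf (a := fun j => a (j + 1)) (D := D * C) (C := C)
      (fun j => (ha (j + 1)).trans (by rw [pow_succ]; apply le_of_eq; ring)) z
    refine hasSum_of_eq (fun j => ?_) h6
    have : (j.factorial : ℂ) ≠ 0 := by exact_mod_cast j.factorial_ne_zero
    have hj : (j : ℂ) + 1 ≠ 0 := by exact_mod_cast j.succ_ne_zero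
    rw [Nat.factorial_succ]
    push_cast
    field_simp
  rw [← h3]
  exact h2

lemma hasSum_mul_egf_succ {a : ℕ → ℂ} {D C : ℝ}
    (ha : ∀ j, ‖a j‖ ≤ D * C ^ j) (z : ℂ) :
    HasSum (fun j : ℕ => j * a j * (z ^ j / (j.factorial : ℂ)))
      (z * egf (fun j => a (j + 1)) z) := by
  have h6 := (hasSum_egf (a := fun j => a (j + 1)) (D := D * C) (C := C)
      (fun j => (ha (j + 1)).trans (by rw [pow_succ]; apply le_of_eq; ring)) z).mul_left z
  have h7 := (hasSum_nat_add_iff (f := fun j : ℕ => j * a j * (z ^ j / (j.factorial : ℂ))) 1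
    (g := z * egf (fun j => a (j + 1)) z)).1 ?_
  · simpa using h7
  refine hasSum_of_eq (fun j => ?_) h6
  have : (j.factorial : ℂ) ≠ 0 := by exact_mod_cast j.factorial_ne_zero
  have hj : (j : ℂ) + 1 ≠ 0 := by exact_mod_cast j.succ_ne_zero
  rw [Nat.factorial_succ]
  push_cast
  field_simp
  ring

/-- Coefficients (times `j!`) of the power series solution of the confluent hypergeometric
equation `2 z w'' + (γ + 4 σ z) w' + σ (γ - μ) w = 0`. -/
def kummerCoeff (γ : ℝ) (σ μ : ℂ) : ℕ → ℂ
  | 0 => 1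
  | j + 1 => -(σ * (4 * j + γ - μ)) / (2 * j + γ) * kummerCoeff γ σ μ j

lemma exists_norm_kummerCoeff_le {γ : ℝ} (hγ : 0 < γ) (σ μ : ℂ) :
    ∃ C : ℝ, ∀ j, ‖kummerCoeff γ σ μ j‖ ≤ 1 * C ^ j := by
  refine ⟨‖σ‖ * (2 + ‖(γ : ℂ) + μ‖ / γ), fun j => ?_⟩
  induction j with
  | zero => simp [kummerCoeff]
  | succ j ih =>
    have hpos : 0 < 2 * (j : ℝ) + γ := by positivity
    have e : (2 * (j : ℂ) + γ) = ((2 * (j : ℝ) + γ : ℝ) : ℂ) := by push_cast; ring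
    have hn : ‖(2 * (j : ℂ) + γ)‖ = 2 * (j : ℝ) + γ := by
      rw [e, Complex.norm_real, Real.norm_of_nonneg hpos.le]
    have h1 : ‖4 * (j : ℂ) + γ - μ‖ / (2 * j + γ) ≤ 2 + ‖(γ : ℂ) + μ‖ / γ := by
      have e2 : 4 * (j : ℂ) + γ - μ = 2 * (2 * j + γ) - (γ + μ) := by ring
      have h3 : ‖4 * (j : ℂ) + γ - μ‖ ≤ 2 * (2 * j + γ) + ‖(γ : ℂ) + μ‖ := by
        rw [e2]
        refine (norm_sub_le _ _).trans ?_
        rw [norm_mul, hn]; simp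
      calc _ ≤ (2 * (2 * j + γ) + ‖(γ : ℂ) + μ‖) / (2 * j + γ) := by gcongr
        _ = 2 + ‖(γ : ℂ) + μ‖ / (2 * j + γ) := by field_simp
        _ ≤ _ := by gcongr; linarith [(Nat.cast_nonneg j : (0 : ℝ) ≤ j)]
    rw [kummerCoeff, norm_mul, norm_div, norm_neg, norm_mul, hn, pow_succ, mul_div_assoc, one_mul]
    rw [one_mul] at ih
    rw [mul_comm]
    gcongr

/-- Existence of an entire solution, normalised at the origin. -/
lemma exists_entire_solution {γ : ℝ} (hγ : 0 < γ) (s μ : ℂ) :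
    ∃ F : ℂ → ℂ, Differentiable ℂ F ∧ F 0 = 1 ∧ ∀ z,
      2 * z * deriv (deriv F) z + γ * deriv F z + (2 * s ^ 2 * z - Complex.I * s * μ) * F z = 0 := by
  set σ : ℂ := Complex.I * s
  have hσ : σ ^ 2 = - s ^ 2 := by simp [σ, mul_pow]
  obtain ⟨C, ha⟩ := exists_norm_kummerCoeff_le hγ σ μ
  set a := kummerCoeff γ σ μ with ha_def
  set a' : ℕ → ℂ := fun j => a (j + 1)
  set a'' : ℕ → ℂ := fun j => a' (j + 1)
  have ha' : ∀ j, ‖a' j‖ ≤ 1 * C * C ^ j := fun j =>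
    (ha (j + 1)).trans (by rw [pow_succ]; apply le_of_eq; ring)
  have hK : ∀ z, HasDerivAt (egf a) (egf a' z) z := hasDerivAt_egf ha
  have hK' : ∀ z, HasDerivAt (egf a') (egf a'' z) z := hasDerivAt_egf ha'
  have hrec : ∀ j : ℕ, (2 * j + γ) * a' j + σ * (4 * j + γ - μ) * a j = 0 := fun j => by
    have hpos : 0 < 2 * (j : ℝ) + γ := by positivity
    have hne : (2 * (j : ℂ) + γ) ≠ 0 := by exact_mod_cast hpos.ne'
    simp only [a', ha_def, kummerCoeff]
    field_simp
    ring
  have hode : ∀ z, 2 * (z * egf a'' z) + γ * egf a' z + 4 * σ * (z * egf a' z)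
      + σ * (γ - μ) * egf a z = 0 := fun z => by
    have h1 := ((hasSum_mul_egf_succ ha' z).mul_left 2).add
      (((hasSum_egf ha' z)).mul_left (γ : ℂ))
    have h2 := (h1.add ((hasSum_mul_egf_succ ha z).mul_left (4 * σ))).add
      ((hasSum_egf ha z).mul_left (σ * (γ - μ)))
    refine h2.unique ?_
    convert hasSum_zero using 2 with j
    linear_combination (z ^ j / (j.factorial : ℂ)) * hrec j
  have he : ∀ z, HasDerivAt (fun z => Complex.exp (σ * z)) (Complex.exp (σ * z) * σ) z :=
    fun z => by simpa using (((hasDerivAt_id z).const_mul σ).cexp)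
  have hF : ∀ z, HasDerivAt (fun z => Complex.exp (σ * z) * egf a z)
      (Complex.exp (σ * z) * (σ * egf a z + egf a' z)) z := fun z => by
    have := (he z).mul (hK z)
    exact this.congr_deriv (by ring)
  have hF' : ∀ z, HasDerivAt (fun z => Complex.exp (σ * z) * (σ * egf a z + egf a' z))
      (Complex.exp (σ * z) * (σ ^ 2 * egf a z + 2 * σ * egf a' z + egf a'' z)) z := fun z => by
    have := (he z).mul (((hK z).const_mul σ).add (hK' z))
    exact this.congr_deriv (by simp only [Pi.add_apply]; ring)
  refine ⟨fun z => Complex.exp (σ * z) * egf a z, fun z => (hF z).differentiableAt, ?_, fun z => ?_⟩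
  · have h0 := hasSum_egf ha 0
    have h1 : egf a 0 = 1 := by
      refine h0.unique ?_
      convert hasSum_single (f := fun j : ℕ => a j * (0 ^ j / (j.factorial : ℂ))) 0 ?_ using 1
      · simp [ha_def, kummerCoeff]
      · intro b hb; simp [hb]
    simp [h1]
  · have e1 : deriv (fun z => Complex.exp (σ * z) * egf a z) =
        fun z => Complex.exp (σ * z) * (σ * egf a z + egf a' z) := funext fun z => (hF z).deriv
    rw [e1, (hF' z).deriv]
    have e2 : Complex.I * s * μ = σ * μ := rfl
    rw [e2]
    linear_combination Complex.exp (σ * z) * hode z +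
      2 * z * Complex.exp (σ * z) * egf a z * hσ

lemma contDiff_mvPolynomial_eval {n : ℕ} (p : MvPolynomial (Fin n) ℂ) :
    ContDiff ℝ (⊤ : ℕ∞) fun y : E n => MvPolynomial.eval (fun j => ((y j : ℝ) : ℂ)) p := by
  induction p using MvPolynomial.induction_on with
  | C a => simpa using contDiff_const
  | add p q hp hq => simpa using hp.add hq
  | mul_X p i hp =>
    have : ContDiff ℝ (⊤ : ℕ∞) fun y : E n => ((y i : ℝ) : ℂ) :=
      Complex.ofRealCLM.contDiff.comp (by fun_prop)
    simpa using hp.mul this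

lemma IsHarmonicHomog.contDiff {n k : ℕ} {h : E n → ℂ} (hh : IsHarmonicHomog k h) :
    ContDiff ℝ (⊤ : ℕ∞) h := by
  obtain ⟨⟨p, hp⟩, -⟩ := hh
  rw [funext hp]
  exact contDiff_mvPolynomial_eval p

/-- The radial equation has a nonzero solution whose product with `h` extends smoothly, as soon
as `λ = l (2 l + 2 k + n - 2)`. -/
lemma exists_radial_solution (n k l : ℕ) (hn : 2 ≤ n) (s μ lam : ℂ)
    (hlam : lam = l * (2 * l + 2 * k + n - 2)) {h : E n → ℂ} (hh : ContDiff ℝ (⊤ : ℕ∞) h) :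
    ∃ ψ : ℝ → ℂ, ContDiffOn ℝ 2 ψ (Ioi 0) ∧ (∃ ρ : ℝ, 0 < ρ ∧ ψ ρ ≠ 0) ∧
      (∀ ρ : ℝ, 0 < ρ →
        (ρ : ℂ) ^ 2 * deriv (deriv ψ) ρ + ((n : ℂ) - 1 + 2 * (k : ℂ)) * (ρ : ℂ) * deriv ψ ρ
          + (4 * s ^ 2 * (ρ : ℂ) ^ 4 - 2 * Complex.I * s * μ * (ρ : ℂ) ^ 2 - 2 * lam) * ψ ρ = 0) ∧
      (∃ g : E n → ℂ, ContDiff ℝ (⊤ : ℕ∞) g ∧ ∀ y : E n, y ≠ 0 → g y = ψ ‖y‖ * h y) := by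
  have hγ : (0 : ℝ) < 4 * l + n + 2 * k := by positivity
  obtain ⟨F, hF, hF0, hode⟩ := exists_entire_solution hγ s μ
  have hFa : ∀ z, HasDerivAt F (deriv F z) z := fun z => (hF z).hasDerivAt
  have hFb : ∀ z, HasDerivAt (deriv F) (deriv (deriv F) z) z := fun z =>
    ((hF.contDiff (n := 2)).differentiable_deriv_two z).hasDerivAt
  set ψ : ℝ → ℂ := fun ρ => (ρ : ℂ) ^ (2 * l) * F ((ρ : ℂ) ^ 2) with hψ
  have hcF : ContDiff ℝ (⊤ : ℕ∞) F := (hF.contDiff (n := (⊤ : ℕ∞))).restrict_scalars ℝ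
  have hof : ContDiff ℝ (⊤ : ℕ∞) fun ρ : ℝ => (ρ : ℂ) := Complex.ofRealCLM.contDiff
  have hψs : ContDiff ℝ (⊤ : ℕ∞) ψ := (hof.pow _).mul (hcF.comp (hof.pow 2))
  refine ⟨ψ, (contDiff_infty.1 hψs 2).contDiffOn, ?_, ?_, ?_⟩
  · by_contra! hcon
    have h1 : Tendsto (fun ρ : ℝ => F ((ρ : ℂ) ^ 2)) (𝓝[>] 0) (𝓝 (F (((0 : ℝ) : ℂ) ^ 2))) :=
      ((hcF.comp (hof.pow 2)).continuous.tendsto 0).mono_left nhdsWithin_le_nhds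
    have h2 : Tendsto (fun ρ : ℝ => F ((ρ : ℂ) ^ 2)) (𝓝[>] 0) (𝓝 0) := by
      refine tendsto_const_nhds.congr' ?_
      filter_upwards [self_mem_nhdsWithin] with ρ hρ
      have hρ' : (ρ : ℂ) ≠ 0 := by exact_mod_cast (ne_of_gt hρ)
      have := hcon ρ hρ
      simp only [hψ, mul_eq_zero, pow_eq_zero_iff', hρ', false_and, false_or] at this
      exact this.symm
    have h3 := tendsto_nhds_unique h1 h2
    simp [hF0] at h3
  · intro ρ hρ
    have hρ' : (ρ : ℂ) ≠ 0 := by exact_mod_cast (ne_of_gt hρ)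
    have hsq : ∀ x : ℂ, HasDerivAt (fun z : ℂ => z ^ 2) (2 * x) x := fun x => by
      simpa using hasDerivAt_pow 2 x
    -- derivatives of `ρ ↦ F (ρ²)` and `ρ ↦ F' (ρ²)`
    have d0 : ∀ x : ℝ, HasDerivAt (fun x : ℝ => F ((x : ℂ) ^ 2))
        (deriv F ((x : ℂ) ^ 2) * (2 * x)) x := fun x =>
      ((hFa _).comp (x : ℂ) (hsq x)).comp_ofReal
    have d1 : ∀ x : ℝ, HasDerivAt (fun x : ℝ => deriv F ((x : ℂ) ^ 2))
        (deriv (deriv F) ((x : ℂ) ^ 2) * (2 * x)) x := fun x =>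
      ((hFb _).comp (x : ℂ) (hsq x)).comp_ofReal
    have dp : ∀ (j : ℕ) (x : ℝ), HasDerivAt (fun x : ℝ => (x : ℂ) ^ j)
        (j * (x : ℂ) ^ (j - 1)) x := fun j x => (hasDerivAt_pow j (x : ℂ)).comp_ofReal
    have D1 : ∀ x : ℝ, HasDerivAt ψ ((2 * l : ℕ) * (x : ℂ) ^ (2 * l - 1) * F ((x : ℂ) ^ 2)
        + (x : ℂ) ^ (2 * l) * (deriv F ((x : ℂ) ^ 2) * (2 * x))) x := fun x =>
      (dp _ x).mul (d0 x)
    have dx : HasDerivAt (fun x : ℝ => 2 * (x : ℂ)) 2 ρ := by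
      simpa using ((hasDerivAt_id (ρ : ℂ)).const_mul 2).comp_ofReal
    have D2 := ((((dp (2 * l - 1) ρ).const_mul ((2 * l : ℕ) : ℂ)).mul (d0 ρ)).add
      ((dp (2 * l) ρ).mul ((d1 ρ).mul dx)))
    have e1 : deriv ψ = fun x : ℝ => (2 * l : ℕ) * (x : ℂ) ^ (2 * l - 1) * F ((x : ℂ) ^ 2)
        + (x : ℂ) ^ (2 * l) * (deriv F ((x : ℂ) ^ 2) * (2 * x)) := funext fun x => (D1 x).deriv
    have D3 := D2.congr_of_eventuallyEq (f₁ := deriv ψ)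
      (Eventually.of_forall fun x => by rw [e1]; rfl)
    rw [D3.deriv, e1]
    simp only [hψ, Pi.mul_apply]
    have ho := hode ((ρ : ℂ) ^ 2)
    push_cast at ho
    have p1 : ((2 * l : ℕ) : ℂ) * (ρ : ℂ) ^ (2 * l - 1) * ρ = (2 * l) * (ρ : ℂ) ^ (2 * l) := by
      rcases l with _ | l
      · simp
      · rw [show 2 * (l + 1) - 1 = 2 * l + 1 by omega]; push_cast; ring
    have p2 : ((2 * l : ℕ) : ℂ) * (((2 * l - 1 : ℕ) : ℂ) * (ρ : ℂ) ^ (2 * l - 1 - 1)) * ρ ^ 2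
        = (2 * l) * (2 * l - 1) * (ρ : ℂ) ^ (2 * l) := by
      rcases l with _ | l
      · simp
      · rw [show 2 * (l + 1) - 1 = 2 * l + 1 by omega, show 2 * l + 1 - 1 = 2 * l by omega]
        push_cast; ring
    subst hlam
    set A := F ((ρ : ℂ) ^ 2)
    set B := deriv F ((ρ : ℂ) ^ 2)
    set D := deriv (deriv F) ((ρ : ℂ) ^ 2)
    linear_combination A * p2 + (4 * ρ ^ 2 * B + (n - 1 + 2 * k) * A) * p1
      + 2 * (ρ : ℂ) ^ 2 * (ρ : ℂ) ^ (2 * l) * ho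
  · have hof2 : ContDiff ℝ (⊤ : ℕ∞) fun y : E n => ((‖y‖ ^ 2 : ℝ) : ℂ) :=
      hof.comp (contDiff_norm_sq ℝ)
    refine ⟨fun y => ((‖y‖ ^ 2 : ℝ) : ℂ) ^ l * F ((‖y‖ ^ 2 : ℝ) : ℂ) * h y,
      ((hof2.pow l).mul (hcF.comp hof2)).mul hh, fun y _ => ?_⟩
    simp only [hψ]
    push_cast
    rw [pow_mul]

lemma tendsto_div_pow_of_iteratedDeriv_eq_zero {f : ℝ → ℂ} (hf : ContDiff ℝ (⊤ : ℕ∞) f) {p : ℕ}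
    (h0 : ∀ i < p, iteratedDeriv i f 0 = 0) :
    Tendsto (fun t : ℝ => f t / (t : ℂ) ^ p) (𝓝[>] 0)
      (𝓝 (iteratedDeriv p f 0 / (p.factorial : ℂ))) := by
  have h1 := taylor_tendsto (f := f) (x₀ := 0) (n := p) convex_univ (mem_univ _)
    (contDiff_infty.1 hf p).contDiffOn
  rw [nhdsWithin_univ] at h1
  have h2 := (h1.mono_left (nhdsWithin_le_nhds (s := Ioi 0))).add_const
    (iteratedDeriv p f 0 / (p.factorial : ℂ))
  rw [zero_add] at h2
  refine h2.congr' ?_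
  filter_upwards [self_mem_nhdsWithin] with t ht
  have ht' : (t : ℂ) ≠ 0 := by exact_mod_cast (ne_of_gt ht)
  have hp : (p.factorial : ℂ) ≠ 0 := by exact_mod_cast p.factorial_ne_zero
  rw [taylor_within_apply, Finset.sum_range_succ, Finset.sum_eq_zero]
  · simp only [iteratedDerivWithin_univ, sub_zero, zero_add, Complex.real_smul]
    push_cast
    field_simp
    ring
  · intro i hi
    rw [iteratedDerivWithin_univ, h0 i (Finset.mem_range.1 hi), smul_zero]

lemma iteratedDeriv_deriv_zero {f : ℝ → ℂ} {q : ℕ}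
    (h0 : ∀ i < q + 1, iteratedDeriv i f 0 = 0) : ∀ i < q, iteratedDeriv i (deriv f) 0 = 0 := by
  intro i hi
  rw [← iteratedDeriv_succ']
  exact h0 _ (by omega)

lemma contDiff_deriv_of_top {f : ℝ → ℂ} (hf : ContDiff ℝ (⊤ : ℕ∞) f) :
    ContDiff ℝ (⊤ : ℕ∞) (deriv f) :=
  (contDiff_infty_iff_deriv.1 hf).2

lemma tendsto_mul_deriv_div_pow {f : ℝ → ℂ} (hf : ContDiff ℝ (⊤ : ℕ∞) f) {p : ℕ}
    (h0 : ∀ i < p, iteratedDeriv i f 0 = 0) :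
    Tendsto (fun t : ℝ => t * deriv f t / (t : ℂ) ^ p) (𝓝[>] 0)
      (𝓝 (p * (iteratedDeriv p f 0 / (p.factorial : ℂ)))) := by
  have hf' := contDiff_deriv_of_top hf
  rcases p with _ | q
  · have : Continuous fun t : ℝ => (t : ℂ) * deriv f t :=
      Complex.continuous_ofReal.mul hf'.continuous
    simpa using (this.tendsto 0).mono_left (nhdsWithin_le_nhds (s := Ioi 0))
  · have h1 := tendsto_div_pow_of_iteratedDeriv_eq_zero hf' (iteratedDeriv_deriv_zero h0)
    have e : ((q + 1 : ℕ) : ℂ) * (iteratedDeriv (q + 1) f 0 / ((q + 1).factorial : ℂ)) =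
        iteratedDeriv q (deriv f) 0 / (q.factorial : ℂ) := by
      have hp : (q.factorial : ℂ) ≠ 0 := by exact_mod_cast q.factorial_ne_zero
      have hq : (q : ℂ) + 1 ≠ 0 := by exact_mod_cast q.succ_ne_zero
      rw [iteratedDeriv_succ', Nat.factorial_succ]
      push_cast
      field_simp
    rw [e]
    refine h1.congr' ?_
    filter_upwards [self_mem_nhdsWithin] with t ht
    have ht' : (t : ℂ) ≠ 0 := by exact_mod_cast (ne_of_gt ht)
    field_simp
    ring

lemma tendsto_sq_mul_deriv_deriv_div_pow {f : ℝ → ℂ} (hf : ContDiff ℝ (⊤ : ℕ∞) f) {p : ℕ}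
    (h0 : ∀ i < p, iteratedDeriv i f 0 = 0) :
    Tendsto (fun t : ℝ => t ^ 2 * deriv (deriv f) t / (t : ℂ) ^ p) (𝓝[>] 0)
      (𝓝 (p * (p - 1) * (iteratedDeriv p f 0 / (p.factorial : ℂ)))) := by
  have hf' := contDiff_deriv_of_top hf
  rcases p with _ | q
  · have : Continuous fun t : ℝ => (t : ℂ) ^ 2 * deriv (deriv f) t :=
      (Complex.continuous_ofReal.pow 2).mul (contDiff_deriv_of_top hf').continuous
    simpa using (this.tendsto 0).mono_left (nhdsWithin_le_nhds (s := Ioi 0))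
  · have h1 := tendsto_mul_deriv_div_pow hf' (iteratedDeriv_deriv_zero h0)
    have e : ((q + 1 : ℕ) : ℂ) * (((q + 1 : ℕ) : ℂ) - 1) *
        (iteratedDeriv (q + 1) f 0 / ((q + 1).factorial : ℂ)) =
        q * (iteratedDeriv q (deriv f) 0 / (q.factorial : ℂ)) := by
      have hp : (q.factorial : ℂ) ≠ 0 := by exact_mod_cast q.factorial_ne_zero
      have hq : (q : ℂ) + 1 ≠ 0 := by exact_mod_cast q.succ_ne_zero
      rw [iteratedDeriv_succ', Nat.factorial_succ]
      push_cast
      field_simp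
      ring
    rw [e]
    refine h1.congr' ?_
    filter_upwards [self_mem_nhdsWithin] with t ht
    have ht' : (t : ℂ) ≠ 0 := by exact_mod_cast (ne_of_gt ht)
    field_simp
    ring

/-- The order of vanishing at `0` of a smooth solution is a root of the indicial equation. -/
lemma indicial_equation {f : ℝ → ℂ} (hf : ContDiff ℝ (⊤ : ℕ∞) f) {α : ℂ} {W : ℝ → ℂ}
    (hW : Continuous W)
    (hode : ∀ t : ℝ, 0 < t → (t : ℂ) ^ 2 * deriv (deriv f) t + α * (t * deriv f t) + W t * f t = 0)
    {p : ℕ} (h0 : ∀ i < p, iteratedDeriv i f 0 = 0) (hp : iteratedDeriv p f 0 ≠ 0) :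
    (p : ℂ) * (p - 1) + α * p + W 0 = 0 := by
  have h1 := ((tendsto_sq_mul_deriv_deriv_div_pow hf h0).add
    ((tendsto_mul_deriv_div_pow hf h0).const_mul α)).add
    (((hW.tendsto 0).mono_left (nhdsWithin_le_nhds (s := Ioi 0))).mul
      (tendsto_div_pow_of_iteratedDeriv_eq_zero hf h0))
  have h2 := tendsto_nhds_unique (h1.congr' (f₂ := fun _ => (0 : ℂ)) ?_) tendsto_const_nhds
  · have hc : iteratedDeriv p f 0 / (p.factorial : ℂ) ≠ 0 :=
      div_ne_zero hp (by exact_mod_cast p.factorial_ne_zero)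
    refine mul_right_cancel₀ hc ?_
    linear_combination h2
  · filter_upwards [self_mem_nhdsWithin] with t ht
    linear_combination ((t : ℂ) ^ p)⁻¹ * hode t ht

/-- A smooth solution that is flat at the regular singular point `0` vanishes on `(0, ∞)`. -/
lemma eq_zero_of_flat {f : ℝ → ℂ} (hf : ContDiff ℝ (⊤ : ℕ∞) f) {α : ℂ} {W : ℝ → ℂ}
    (hW : Continuous W)
    (hode : ∀ t : ℝ, 0 < t → (t : ℂ) ^ 2 * deriv (deriv f) t + α * (t * deriv f t) + W t * f t = 0)
    (h0 : ∀ i, iteratedDeriv i f 0 = 0) (r : ℝ) (hr : 0 < r) : f r = 0 := by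
  have hf' := contDiff_deriv_of_top hf
  obtain ⟨Q, hQ⟩ := (isCompact_Icc (a := (0 : ℝ)) (b := r)).exists_bound_of_continuousOn
    hW.continuousOn
  have hQ0 : 0 ≤ Q := (norm_nonneg _).trans (hQ 0 ⟨le_rfl, hr.le⟩)
  obtain ⟨N, hN⟩ := exists_nat_ge (1 + Q + 2 * ‖1 - α‖)
  -- weighted energy
  set u : ℝ → ℂ := fun t => t * deriv f t with hu
  set e : ℝ → ℝ := fun t => ‖f t‖ ^ 2 + ‖u t‖ ^ 2 with he
  have dof : ∀ t : ℝ, HasDerivAt (fun t : ℝ => (t : ℂ)) 1 t := fun t =>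
    (hasDerivAt_id (t : ℂ)).comp_ofReal
  have df : ∀ t, HasDerivAt f (deriv f t) t := fun t =>
    (hf.differentiable (by simp) t).hasDerivAt
  have du : ∀ t, HasDerivAt u (1 * deriv f t + t * deriv (deriv f) t) t := fun t =>
    (dof t).mul (hf'.differentiable (by simp) t).hasDerivAt
  have de : ∀ t, HasDerivAt e (2 * inner ℝ (f t) (deriv f t) +
      2 * inner ℝ (u t) (1 * deriv f t + t * deriv (deriv f) t)) t := fun t =>
    (df t).norm_sq.add (du t).norm_sq
  have dE : ∀ t : ℝ, 0 < t → HasDerivAt (fun t : ℝ => e t / t ^ N)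
      (((2 * inner ℝ (f t) (deriv f t) +
      2 * inner ℝ (u t) (1 * deriv f t + t * deriv (deriv f) t)) * t ^ N -
      e t * (N * t ^ (N - 1))) / (t ^ N) ^ 2) t := fun t ht =>
    (de t).div (hasDerivAt_pow N t) (by positivity)
  have key : ∀ t : ℝ, 0 < t → t ≤ r → t * (2 * inner ℝ (f t) (deriv f t) +
      2 * inner ℝ (u t) (1 * deriv f t + t * deriv (deriv f) t)) ≤ N * e t := by
    intro t ht htr
    have e1 : t * inner ℝ (f t) (deriv f t) = inner ℝ (f t) (u t) := by
      rw [hu, ← real_inner_smul_right, Complex.real_smul]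
    have e2 : t * inner ℝ (u t) (1 * deriv f t + t * deriv (deriv f) t) =
        inner ℝ (u t) ((1 - α) * u t - W t * f t) := by
      rw [← real_inner_smul_right, Complex.real_smul]
      congr 1
      simp only [hu]
      linear_combination hode t ht
    have b1 : inner ℝ (f t) (u t) ≤ ‖f t‖ * ‖u t‖ := real_inner_le_norm _ _
    have b2 : inner ℝ (u t) ((1 - α) * u t - W t * f t) ≤
        ‖u t‖ * (‖1 - α‖ * ‖u t‖ + Q * ‖f t‖) := by
      refine (real_inner_le_norm _ _).trans ?_
      gcongr
      refine (norm_sub_le _ _).trans ?_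
      rw [norm_mul, norm_mul (W t)]
      have := hQ t ⟨ht.le, htr⟩
      gcongr
    have b3 : (1 + Q + 2 * ‖1 - α‖) * e t ≤ N * e t := by
      have : 0 ≤ e t := by positivity
      gcongr
    have : t * (2 * inner ℝ (f t) (deriv f t) +
      2 * inner ℝ (u t) (1 * deriv f t + t * deriv (deriv f) t)) =
      2 * inner ℝ (f t) (u t) + 2 * inner ℝ (u t) ((1 - α) * u t - W t * f t) := by
      rw [← e1, ← e2]; ring
    rw [this]
    refine le_trans ?_ b3
    have h1 : 0 ≤ (1 + Q) * (‖f t‖ - ‖u t‖) ^ 2 := by positivity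
    have h2 : 0 ≤ ‖1 - α‖ * ‖f t‖ ^ 2 := by positivity
    simp only [he]
    nlinarith
  have anti : AntitoneOn (fun t : ℝ => e t / t ^ N) (Ioc 0 r) := by
    refine antitoneOn_of_deriv_nonpos (convex_Ioc 0 r)
      (fun t ht => (dE t ht.1).continuousAt.continuousWithinAt) (fun t ht => ?_) (fun t ht => ?_)
    · rw [interior_Ioc] at ht
      exact (dE t ht.1).differentiableAt.differentiableWithinAt
    · rw [interior_Ioc] at ht
      rw [(dE t ht.1).deriv]
      have ht0 : 0 < t := ht.1
      refine div_nonpos_of_nonpos_of_nonneg ?_ (by positivity)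
      have k := key t ht.1 ht.2.le
      refine nonpos_of_mul_nonpos_right (a := t) ?_ ht0
      have e3 : (N : ℝ) * t ^ (N - 1) * t = N * t ^ N := by
        rcases N with _ | N
        · simp
        · simp [pow_succ, mul_assoc]
      have : 0 ≤ t ^ N := by positivity
      linear_combination mul_le_mul_of_nonneg_right k this - e t * e3
  have lim : Tendsto (fun t : ℝ => e t / t ^ N) (𝓝[>] 0) (𝓝 0) := by
    have l1 := tendsto_div_pow_of_iteratedDeriv_eq_zero hf (p := N) (fun i _ => h0 i)
    have l2 := tendsto_mul_deriv_div_pow hf (p := N) (fun i _ => h0 i)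
    rw [h0 N, zero_div] at l1
    rw [h0 N, zero_div, mul_zero] at l2
    have l3 := ((l1.norm.pow 2).add (l2.norm.pow 2)).mul
      (((continuous_pow N (M := ℝ)).tendsto 0).mono_left (nhdsWithin_le_nhds (s := Ioi 0)))
    simp only [norm_zero, ne_eq, OfNat.ofNat_ne_zero, not_false_eq_true, zero_pow, add_zero,
      zero_mul] at l3
    refine l3.congr' ?_
    filter_upwards [self_mem_nhdsWithin] with t ht
    have ht0 : 0 < t := ht
    simp only [he, hu, norm_div, norm_pow, Complex.norm_real, Real.norm_of_nonneg ht0.le]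
    field_simp
  have fin : e r / r ^ N ≤ 0 := by
    refine ge_of_tendsto lim ?_
    filter_upwards [Ioo_mem_nhdsGT hr] with t ht
    exact anti ⟨ht.1, ht.2.le⟩ ⟨hr, le_rfl⟩ ht.2.le
  have h3 : e r ≤ 0 := by
    by_contra! h
    have : 0 < e r / r ^ N := by positivity
    linarith
  have h4 : ‖f r‖ ^ 2 ≤ 0 := by
    have : 0 ≤ ‖u r‖ ^ 2 := by positivity
    simp only [he] at h3
    linarith
  simpa using le_antisymm h4 (by positivity)

lemma contDiff_pd {n : ℕ} (j : Fin n) {f : E n → ℂ} (hf : ContDiff ℝ (⊤ : ℕ∞) f) :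
    ContDiff ℝ (⊤ : ℕ∞) (pd j f) :=
  (hf.fderiv_right (m := (⊤ : ℕ∞)) (by simp)).clm_apply contDiff_const

lemma contDiff_lap {n : ℕ} {f : E n → ℂ} (hf : ContDiff ℝ (⊤ : ℕ∞) f) :
    ContDiff ℝ (⊤ : ℕ∞) (lap f) :=
  ContDiff.sum fun j _ => contDiff_pd j (contDiff_pd j hf)

lemma pd_mul {n : ℕ} (j : Fin n) {f g : E n → ℂ} (hf : ContDiff ℝ (⊤ : ℕ∞) f)
    (hg : ContDiff ℝ (⊤ : ℕ∞) g) (y : E n) :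
    pd j (fun y => f y * g y) y = f y * pd j g y + pd j f y * g y := by
  have h1 := fderiv_fun_mul (hf.differentiable (by simp) y) (hg.differentiable (by simp) y)
  simp only [pd, h1]
  simp
  ring

lemma pd_add {n : ℕ} (j : Fin n) {f g : E n → ℂ} (hf : ContDiff ℝ (⊤ : ℕ∞) f)
    (hg : ContDiff ℝ (⊤ : ℕ∞) g) (y : E n) :
    pd j (fun y => f y + g y) y = pd j f y + pd j g y := by
  have h1 := fderiv_fun_add (hf.differentiable (by simp) y) (hg.differentiable (by simp) y)
  simp only [pd, h1]
  simp

lemma pd_const_mul {n : ℕ} (j : Fin n) (c : ℂ) {f : E n → ℂ} (hf : ContDiff ℝ (⊤ : ℕ∞) f)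
    (y : E n) : pd j (fun y => c * f y) y = c * pd j f y := by
  have h1 := fderiv_const_mul (hf.differentiable (by simp) y) c
  simp only [pd, h1]
  simp

lemma contDiff_coord {n : ℕ} (j : Fin n) :
    ContDiff ℝ (⊤ : ℕ∞) fun y : E n => ((y j : ℝ) : ℂ) :=
  Complex.ofRealCLM.contDiff.comp (by fun_prop)

lemma pd_coord {n : ℕ} (i j : Fin n) (y : E n) :
    pd j (fun y : E n => ((y i : ℝ) : ℂ)) y = if i = j then 1 else 0 := by
  have h1 : HasFDerivAt (fun y : E n => ((y i : ℝ) : ℂ))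
      (Complex.ofRealCLM.comp (EuclideanSpace.proj (𝕜 := ℝ) i)) y :=
    (Complex.ofRealCLM.comp (EuclideanSpace.proj (𝕜 := ℝ) i)).hasFDerivAt
  simp only [pd, h1.fderiv]
  by_cases h : i = j <;> simp [h]

/-- The squared Euclidean norm, as a complex number. -/
def normSqC {n : ℕ} (y : E n) : ℂ := ((‖y‖ ^ 2 : ℝ) : ℂ)

lemma contDiff_normSqC {n : ℕ} : ContDiff ℝ (⊤ : ℕ∞) (normSqC (n := n)) :=
  Complex.ofRealCLM.contDiff.comp (contDiff_norm_sq ℝ)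

lemma normSqC_eq_sum {n : ℕ} (y : E n) : normSqC y = ∑ j, ((y j : ℝ) : ℂ) ^ 2 := by
  simp [normSqC, EuclideanSpace.real_norm_sq_eq]

lemma pd_normSqC {n : ℕ} (j : Fin n) (y : E n) : pd j normSqC y = 2 * ((y j : ℝ) : ℂ) := by
  have h1 : HasFDerivAt (normSqC (n := n)) (Complex.ofRealCLM.comp (2 • (innerSL ℝ y))) y :=
    Complex.ofRealCLM.hasFDerivAt.comp y (hasStrictFDerivAt_norm_sq y).hasFDerivAt
  simp only [pd, h1.fderiv]
  simp [EuclideanSpace.inner_single_right]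

lemma pd_normSqC_pow_succ {n : ℕ} (j : Fin n) (q : ℕ) (y : E n) :
    pd j (fun y => normSqC y ^ (q + 1)) y =
      2 * (q + 1) * (normSqC y ^ q * ((y j : ℝ) : ℂ)) := by
  induction q with
  | zero => simp [pd_normSqC]
  | succ q ih =>
    have h1 := pd_mul j (contDiff_normSqC.pow (q + 1)) contDiff_normSqC y
    simp_rw [pow_succ _ (q + 1)]
    rw [h1, ih, pd_normSqC]
    push_cast
    ring

lemma fderiv_self_eq_sum_pd {n : ℕ} (f : E n → ℂ) (y : E n) :
    fderiv ℝ f y y = ∑ j, ((y j : ℝ) : ℂ) * pd j f y := by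
  have h1 := congrArg (fderiv ℝ f y) ((EuclideanSpace.basisFun (Fin n) ℝ).sum_repr y)
  rw [map_sum] at h1
  rw [← h1]
  simp [pd]

/-- Euler's identity for homogeneous functions. -/
lemma sum_mul_pd_of_homogeneous {n k : ℕ} {h : E n → ℂ} (hs : ContDiff ℝ (⊤ : ℕ∞) h)
    (hom : ∀ (t : ℝ) (y : E n), h (t • y) = (t : ℂ) ^ k * h y) (y : E n) :
    ∑ j, ((y j : ℝ) : ℂ) * pd j h y = k * h y := by
  rw [← fderiv_self_eq_sum_pd]
  have h1 : HasDerivAt (fun t : ℝ => h (t • y)) (fderiv ℝ h y y) 1 := by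
    have h2 : HasDerivAt (fun t : ℝ => t • y) y 1 := by
      simpa using (hasDerivAt_id (1 : ℝ)).smul_const y
    have h3 : HasFDerivAt h (fderiv ℝ h y) ((1 : ℝ) • y) := by
      rw [one_smul]; exact (hs.differentiable (by simp) y).hasFDerivAt
    exact h3.comp_hasDerivAt 1 h2
  have h4 : HasDerivAt (fun t : ℝ => h (t • y)) (k * h y) 1 := by
    simp_rw [hom]
    simpa using ((hasDerivAt_pow k ((1 : ℝ) : ℂ)).comp_ofReal).mul_const (h y)
  exact h1.unique h4

lemma lap_normSqC_pow_mul {n : ℕ} {f : E n → ℂ} (hf : ContDiff ℝ (⊤ : ℕ∞) f) (q : ℕ) (y : E n) :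
    lap (fun y => normSqC y ^ (q + 1) * f y) y =
      normSqC y ^ q * (normSqC y * lap f y + 4 * (q + 1) * ∑ j, ((y j : ℝ) : ℂ) * pd j f y
        + 2 * (q + 1) * (n + 2 * q) * f y) := by
  have e1 : ∀ j, pd j (fun y => normSqC y ^ (q + 1) * f y) = fun y =>
      normSqC y ^ (q + 1) * pd j f y + 2 * (q + 1) * (normSqC y ^ q * (((y j : ℝ) : ℂ) * f y)) :=
    fun j => funext fun y => by
      rw [pd_mul j (contDiff_normSqC.pow (q + 1)) hf, pd_normSqC_pow_succ]; ring
  have e2 : ∀ j, pd j (pd j (fun y => normSqC y ^ (q + 1) * f y)) y =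
      normSqC y ^ (q + 1) * pd j (pd j f) y + 4 * (q + 1) * normSqC y ^ q *
        (((y j : ℝ) : ℂ) * pd j f y) + 2 * (q + 1) * normSqC y ^ q * f y
        + 4 * (q + 1) * q * normSqC y ^ (q - 1) * f y * ((y j : ℝ) : ℂ) ^ 2 := fun j => by
    have hx := (contDiff_coord j).mul hf
    have hq := contDiff_normSqC (n := n).pow q
    have h4 : pd j (fun y => normSqC y ^ q) y =
        2 * q * (normSqC y ^ (q - 1) * ((y j : ℝ) : ℂ)) := by
      rcases q with _ | q
      · simp [pd]
      · rw [pd_normSqC_pow_succ]; push_cast; rfl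
    rw [e1, pd_add j ((contDiff_normSqC.pow (q + 1)).mul (contDiff_pd j hf))
      (contDiff_const.mul (hq.mul hx)), pd_const_mul j _ (hq.mul hx), pd_mul j hq hx,
      pd_mul j (contDiff_coord j) hf, pd_coord, pd_mul j (contDiff_normSqC.pow (q + 1))
      (contDiff_pd j hf), pd_normSqC_pow_succ, h4, if_pos rfl]
    ring
  have e3 : (q : ℂ) * normSqC y ^ (q - 1) * normSqC y = q * normSqC y ^ q := by
    rcases q with _ | q
    · simp
    · simp [pow_succ, mul_assoc]
  rw [lap, Finset.sum_congr rfl fun j _ => e2 j, Finset.sum_add_distrib, Finset.sum_add_distrib,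
    Finset.sum_add_distrib, ← Finset.mul_sum, ← Finset.mul_sum, ← Finset.mul_sum,
    ← Finset.mul_sum, ← normSqC_eq_sum, Finset.sum_const, Finset.card_univ, Fintype.card_fin, nsmul_eq_mul, lap]
  linear_combination 4 * (q + 1) * f y * e3

lemma normSqC_ne_zero {n : ℕ} {y : E n} (hy : y ≠ 0) : normSqC y ≠ 0 := by
  simp [normSqC, hy]

lemma normSqC_zero {n : ℕ} : normSqC (0 : E n) = 0 := by
  simp [normSqC]

/-- If a harmonic homogeneous function is smoothly divisible by `‖y‖^(2 (q + 1))`, it is smoothly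
divisible by the next power of `‖y‖²`. -/
lemma exists_eq_normSqC_pow_succ_mul {n k : ℕ} (hn : 2 ≤ n) {h : E n → ℂ}
    (hh : IsHarmonicHomog k h) {q : ℕ} (hq : q + 1 < k) {f : E n → ℂ}
    (hf : ContDiff ℝ (⊤ : ℕ∞) f) (hfh : ∀ y, h y = normSqC y ^ (q + 1) * f y) :
    ∃ f' : E n → ℂ, ContDiff ℝ (⊤ : ℕ∞) f' ∧ ∀ y, h y = normSqC y ^ (q + 2) * f' y := by
  obtain ⟨d, rfl⟩ : ∃ d, k = q + 2 + d := ⟨k - (q + 2), by omega⟩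
  obtain ⟨e, rfl⟩ : ∃ e, n = 2 + e := ⟨n - 2, by omega⟩
  have hc : 2 * ((q : ℂ) + 1) * (2 * d + 2 + e) ≠ 0 := by
    have : ((2 * (q + 1) * (2 * d + 2 + e) : ℕ) : ℂ) ≠ 0 := by
      rw [Nat.cast_ne_zero]; positivity
    exact_mod_cast this
  obtain ⟨c, hc'⟩ : ∃ c : ℂ, c * (2 * ((q : ℂ) + 1) * (2 * d + 2 + e)) = 1 :=
    ⟨_, inv_mul_cancel₀ hc⟩
  refine ⟨fun y => -c * lap f y,
    contDiff_const.mul (contDiff_lap hf), fun y => ?_⟩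
  rcases eq_or_ne y 0 with rfl | hy
  · simp [hfh, normSqC_zero]
  have hR := normSqC_ne_zero hy
  have h1 := hh.2.2 y
  have h2 := sum_mul_pd_of_homogeneous hh.contDiff hh.2.1 y
  rw [funext hfh, lap_normSqC_pow_mul hf] at h1
  have h3 : ∑ j, ((y j : ℝ) : ℂ) * pd j h y =
      normSqC y ^ (q + 1) * ∑ j, ((y j : ℝ) : ℂ) * pd j f y
        + 2 * (q + 1) * normSqC y ^ (q + 1) * f y := by
    have h4 : ∀ j, ((y j : ℝ) : ℂ) * pd j h y = normSqC y ^ (q + 1) * (((y j : ℝ) : ℂ) * pd j f y)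
        + 2 * (q + 1) * normSqC y ^ q * f y * ((y j : ℝ) : ℂ) ^ 2 := fun j => by
      rw [funext hfh, pd_mul j (contDiff_normSqC.pow (q + 1)) hf, pd_normSqC_pow_succ]; ring
    rw [Finset.sum_congr rfl fun j _ => h4 j, Finset.sum_add_distrib, ← Finset.mul_sum,
      ← Finset.mul_sum, ← normSqC_eq_sum]
    ring
  rw [h2, hfh] at h3
  have h5 : ∑ j, ((y j : ℝ) : ℂ) * pd j f y = ((d : ℂ) - q) * f y := by
    refine mul_left_cancel₀ (pow_ne_zero (q + 1) hR) ?_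
    push_cast at h3
    linear_combination -h3
  rw [h5] at h1
  have h6 := (mul_eq_zero.1 h1).resolve_left (pow_ne_zero q hR)
  rw [hfh]
  push_cast at h6
  linear_combination normSqC y ^ (q + 1) * c * h6 - normSqC y ^ (q + 1) * f y * hc'

/-- A nonzero harmonic homogeneous function is not smoothly divisible by `‖y‖²`. -/
lemma not_exists_eq_normSqC_pow_mul {n k : ℕ} (hn : 2 ≤ n) {h : E n → ℂ}
    (hh : IsHarmonicHomog k h) {ω : E n} (hω : h ω ≠ 0) {q : ℕ} (hq : 1 ≤ q) (hqk : q ≤ k) :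
    ¬ ∃ f : E n → ℂ, ContDiff ℝ (⊤ : ℕ∞) f ∧ ∀ y, h y = normSqC y ^ q * f y := by
  intro hex
  have hk : ∃ f : E n → ℂ, ContDiff ℝ (⊤ : ℕ∞) f ∧ ∀ y, h y = normSqC y ^ k * f y := by
    refine Nat.le_induction (m := q) (P := fun j _ => j ≤ k → ∃ f : E n → ℂ,
      ContDiff ℝ (⊤ : ℕ∞) f ∧ ∀ y, h y = normSqC y ^ j * f y) (fun _ => hex) ?_ k hqk le_rfl
    intro j hj ih hjk
    obtain ⟨f, hf, hfh⟩ := ih (by omega)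
    obtain ⟨i, rfl⟩ : ∃ i, j = i + 1 := ⟨j - 1, by omega⟩
    exact exists_eq_normSqC_pow_succ_mul hn hh (by omega) hf hfh
  obtain ⟨f, hf, hfh⟩ := hk
  have hc : Continuous fun t : ℝ => (t : ℂ) ^ k * (normSqC ω ^ k * f (t • ω)) := by
    have := hf.continuous
    fun_prop
  have h1 : Tendsto (fun t : ℝ => (t : ℂ) ^ k * (normSqC ω ^ k * f (t • ω))) (𝓝[>] 0) (𝓝 0) := by
    have := (hc.tendsto 0).mono_left (nhdsWithin_le_nhds (s := Ioi 0))
    simpa [show k ≠ 0 by omega] using this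
  refine hω (tendsto_nhds_unique (tendsto_const_nhds.congr' ?_) h1)
  filter_upwards [self_mem_nhdsWithin] with t ht
  have ht' : (t : ℂ) ≠ 0 := by exact_mod_cast (ne_of_gt ht)
  have h2 := hfh (t • ω)
  have h3 : normSqC (t • ω) = (t : ℂ) ^ 2 * normSqC ω := by
    simp [normSqC, norm_smul, mul_pow, ← Complex.ofReal_pow]
  rw [hh.2.1, h3] at h2
  refine mul_left_cancel₀ (pow_ne_zero k ht') ?_
  rw [h2]
  ring

lemma iteratedDeriv_zero_eq_of_eq_on_pos {f₁ f₂ : ℝ → ℂ} (h₁ : ContDiff ℝ (⊤ : ℕ∞) f₁)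
    (h₂ : ContDiff ℝ (⊤ : ℕ∞) f₂) (heq : ∀ t : ℝ, 0 < t → f₁ t = f₂ t) (p : ℕ) :
    iteratedDeriv p f₁ 0 = iteratedDeriv p f₂ 0 := by
  have c₁ := (h₁.continuous_iteratedDeriv p (by exact_mod_cast le_top)).tendsto 0
  have c₂ := (h₂.continuous_iteratedDeriv p (by exact_mod_cast le_top)).tendsto 0
  have d₁ := c₁.mono_left (nhdsWithin_le_nhds (s := Ioi 0))
  refine tendsto_nhds_unique (d₁.congr' ?_) (c₂.mono_left (nhdsWithin_le_nhds (s := Ioi 0)))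
  filter_upwards [self_mem_nhdsWithin] with t ht
  refine Filter.EventuallyEq.iteratedDeriv_eq p ?_
  filter_upwards [Ioi_mem_nhds ht] with x hx using heq x hx

lemma iteratedDeriv_comp_smul_zero {n : ℕ} {g : E n → ℂ} (hg : ContDiff ℝ (⊤ : ℕ∞) g) (p : ℕ)
    (y : E n) :
    iteratedDeriv p (fun t : ℝ => g (t • y)) 0 = iteratedFDeriv ℝ p g 0 fun _ => y := by
  have h1 := (ContinuousLinearMap.toSpanSingleton ℝ y).iteratedFDeriv_comp_right hg 0
    (i := p) (by exact_mod_cast le_top)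
  have h2 : (g ∘ ContinuousLinearMap.toSpanSingleton ℝ y) = fun t : ℝ => g (t • y) := by
    ext t; simp
  rw [h2] at h1
  rw [iteratedDeriv_eq_iteratedFDeriv, h1]
  simp

/-- The equation satisfied by `t ↦ tᵏ ψ(t)` when `ψ` solves the radial equation. -/
lemma ode_pow_mul {ψ : ℝ → ℂ} (hψ : ContDiffOn ℝ 2 ψ (Ioi 0)) {n k : ℕ} {V : ℝ → ℂ}
    (hode : ∀ t : ℝ, 0 < t → (t : ℂ) ^ 2 * deriv (deriv ψ) t
      + ((n : ℂ) - 1 + 2 * (k : ℂ)) * (t : ℂ) * deriv ψ t + V t * ψ t = 0)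
    {f : ℝ → ℂ} (hf : ∀ t : ℝ, 0 < t → f t = (t : ℂ) ^ k * ψ t) (t : ℝ) (ht : 0 < t) :
    (t : ℂ) ^ 2 * deriv (deriv f) t + ((n : ℂ) - 1) * (t * deriv f t)
      + (V t - k * (k + n - 2)) * f t = 0 := by
  have d1 : ∀ x : ℝ, 0 < x → HasDerivAt ψ (deriv ψ x) x := fun x hx =>
    ((hψ.differentiableOn (by simp)).differentiableAt (Ioi_mem_nhds hx)).hasDerivAt
  have hψ' : ContDiffOn ℝ 1 (deriv ψ) (Ioi 0) :=
    hψ.deriv_of_isOpen isOpen_Ioi (by norm_num)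
  have d2 : HasDerivAt (deriv ψ) (deriv (deriv ψ) t) t :=
    ((hψ'.differentiableOn (by simp)).differentiableAt (Ioi_mem_nhds ht)).hasDerivAt
  have dp : ∀ (j : ℕ) (x : ℝ), HasDerivAt (fun x : ℝ => (x : ℂ) ^ j)
      (j * (x : ℂ) ^ (j - 1)) x := fun j x => (hasDerivAt_pow j (x : ℂ)).comp_ofReal
  have D1 : ∀ x : ℝ, 0 < x → HasDerivAt f
      (k * (x : ℂ) ^ (k - 1) * ψ x + (x : ℂ) ^ k * deriv ψ x) x := fun x hx =>
    ((dp k x).mul (d1 x hx)).congr_of_eventuallyEq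
      (by filter_upwards [Ioi_mem_nhds hx] with z hz using hf z hz)
  have D2 := ((((dp (k - 1) t).const_mul (k : ℂ)).mul (d1 t ht)).add
    ((dp k t).mul d2)).congr_of_eventuallyEq (f₁ := deriv f)
      (by filter_upwards [Ioi_mem_nhds ht] with z hz using (D1 z hz).deriv)
  rw [D2.deriv, (D1 t ht).deriv, hf t ht]
  have p1 : (k : ℂ) * (t : ℂ) ^ (k - 1) * t = k * (t : ℂ) ^ k := by
    rcases k with _ | k
    · simp
    · simp [pow_succ, mul_assoc]
  have p2 : (k : ℂ) * (((k - 1 : ℕ) : ℂ) * (t : ℂ) ^ (k - 1 - 1)) * t ^ 2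
      = k * (k - 1) * (t : ℂ) ^ k := by
    rcases k with _ | _ | k
    · simp
    · simp
    · simp only [Nat.add_sub_cancel]
      push_cast
      ring
  linear_combination (t : ℂ) ^ k * hode t ht + ψ t * p2
    + (2 * t * deriv ψ t + (n - 1) * ψ t) * p1

lemma exists_unit_ne_zero {n k : ℕ} (hn : 2 ≤ n) {h : E n → ℂ}
    (hom : ∀ (t : ℝ) (y : E n), h (t • y) = (t : ℂ) ^ k * h y) (hne : h ≠ 0) :
    ∃ ω : E n, ‖ω‖ = 1 ∧ h ω ≠ 0 := by
  have hne' : ∃ y : E n, y ≠ 0 ∧ h y ≠ 0 := by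
    obtain ⟨y, hy⟩ := Function.ne_iff.1 hne
    rcases eq_or_ne y 0 with rfl | hy0
    · refine ⟨EuclideanSpace.single ⟨0, by omega⟩ 1, by simp, fun hz => hy ?_⟩
      have := hom 0 (EuclideanSpace.single ⟨0, by omega⟩ 1)
      rw [hz, zero_smul, mul_zero] at this
      exact this
    · exact ⟨y, hy0, hy⟩
  obtain ⟨y, hy0, hy⟩ := hne'
  refine ⟨‖y‖⁻¹ • y, norm_smul_inv_norm hy0, ?_⟩
  rw [hom]
  exact mul_ne_zero (pow_ne_zero _ (by simpa using hy0)) hy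

lemma eigenvalue_of_radial_solution {n k : ℕ} (hn : 2 ≤ n) {s μ lam : ℂ}
    {h : E n → ℂ} (hh : IsHarmonicHomog k h) (hne : h ≠ 0) {ψ : ℝ → ℂ}
    (hψ : ContDiffOn ℝ 2 ψ (Ioi 0)) (hψ0 : ∃ ρ : ℝ, 0 < ρ ∧ ψ ρ ≠ 0)
    (hode : ∀ ρ : ℝ, 0 < ρ →
        (ρ : ℂ) ^ 2 * deriv (deriv ψ) ρ + ((n : ℂ) - 1 + 2 * (k : ℂ)) * (ρ : ℂ) * deriv ψ ρ
          + (4 * s ^ 2 * (ρ : ℂ) ^ 4 - 2 * Complex.I * s * μ * (ρ : ℂ) ^ 2 - 2 * lam) * ψ ρ = 0)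
    {g : E n → ℂ} (hg : ContDiff ℝ (⊤ : ℕ∞) g) (hgψ : ∀ y : E n, y ≠ 0 → g y = ψ ‖y‖ * h y) :
    ∃ l : ℕ, lam = l * (2 * l + 2 * k + n - 2) := by
  have hom := hh.2.1
  obtain ⟨ω, hω1, hω⟩ := exists_unit_ne_zero hn hom hne
  have hline : ∀ y : E n, ContDiff ℝ (⊤ : ℕ∞) fun t : ℝ => g (t • y) := fun y =>
    hg.comp (contDiff_id.smul contDiff_const)
  have hgt : ∀ (y : E n) (t : ℝ), y ≠ 0 → 0 < t →
      g (t • y) = ψ (t * ‖y‖) * ((t : ℂ) ^ k * h y) := fun y t hy ht => by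
    rw [hgψ _ (smul_ne_zero ht.ne' hy), hom, norm_smul, Real.norm_of_nonneg ht.le]
  have hω0 : ω ≠ 0 := by
    rintro rfl
    simp at hω1
  -- the restriction of `g` to the line through `ω`
  set f : ℝ → ℂ := fun t => (h ω)⁻¹ * g (t • ω) with hf_def
  have hf : ContDiff ℝ (⊤ : ℕ∞) f := contDiff_const.mul (hline ω)
  have hfψ : ∀ t : ℝ, 0 < t → f t = (t : ℂ) ^ k * ψ t := fun t ht => by
    simp only [hf_def, hgt ω t hω0 ht, hω1, mul_one]
    field_simp
  set W : ℝ → ℂ := fun t => 4 * s ^ 2 * (t : ℂ) ^ 4 - 2 * Complex.I * s * μ * (t : ℂ) ^ 2 - 2 * lam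
    - k * (k + n - 2) with hW_def
  have hW : Continuous W := by fun_prop
  have hodef := ode_pow_mul hψ hode hfψ
  have hfin : ∃ p, iteratedDeriv p f 0 ≠ 0 := by
    by_contra! hflat
    obtain ⟨ρ, hρ, hρ0⟩ := hψ0
    have h1 := eq_zero_of_flat hf hW hodef hflat ρ hρ
    rw [hfψ ρ hρ] at h1
    exact mul_ne_zero (pow_ne_zero k (by exact_mod_cast hρ.ne')) hρ0 h1
  obtain ⟨p, hp, hmin⟩ : ∃ p, iteratedDeriv p f 0 ≠ 0 ∧ ∀ i < p, iteratedDeriv i f 0 = 0 :=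
    ⟨Nat.find hfin, Nat.find_spec hfin, fun i hi => not_not.1 (Nat.find_min hfin hi)⟩
  have hind := indicial_equation hf hW hodef hmin hp
  -- the leading homogeneous part of `g` at the origin
  set G : E n → ℂ := fun y => iteratedFDeriv ℝ p g 0 fun _ => y with hG_def
  have hG : ContDiff ℝ (⊤ : ℕ∞) G :=
    (iteratedFDeriv ℝ p g 0).contDiff.comp (contDiff_pi.2 fun _ => contDiff_id)
  have hGh : ∀ y : E n, y ≠ 0 →
      (‖y‖ : ℂ) ^ k * G y = iteratedDeriv p f 0 * (‖y‖ : ℂ) ^ p * h y := fun y hy => by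
    have hfy : ContDiff ℝ (⊤ : ℕ∞) fun t : ℝ => f (‖y‖ * t) :=
      hf.comp (contDiff_const.mul contDiff_id)
    have h1 := iteratedDeriv_zero_eq_of_eq_on_pos
      (f₁ := fun t => (‖y‖ : ℂ) ^ k * g (t • y)) (f₂ := fun t => h y * f (‖y‖ * t))
      (contDiff_const.mul (hline y)) (contDiff_const.mul hfy)
      (fun t ht => by
        rw [hgt y t hy ht, hfψ _ (mul_pos (norm_pos_iff.2 hy) ht), mul_comm t]
        push_cast
        ring) p
    rw [iteratedDeriv_const_mul_field, iteratedDeriv_const_mul_field,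
      iteratedDeriv_comp_smul_zero hg, iteratedDeriv_comp_const_smul (contDiff_infty.1 hf p)] at h1
    rw [h1]
    simp
    ring
  have hneg : (-1 : ℂ) ^ p = (-1) ^ k := by
    have h1 := hGh ω hω0
    have h2 := hGh (-ω) (neg_ne_zero.2 hω0)
    have h3 : G (-ω) = (-1) ^ p * G ω := by
      have := (iteratedFDeriv ℝ p g 0).map_smul_univ (fun _ => (-1 : ℝ)) (fun _ => ω)
      simp only [neg_smul, one_smul, Finset.prod_const, Finset.card_univ, Fintype.card_fin,
        Complex.real_smul] at this
      simpa [hG_def] using this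
    have h4 : h (-ω) = (-1) ^ k * h ω := by
      simpa using hom (-1) ω
    rw [norm_neg, h3, h4] at h2
    simp only [hω1, Complex.ofReal_one, one_pow, one_mul, mul_one] at h1 h2
    refine mul_right_cancel₀ (mul_ne_zero hp hω) ?_
    rw [h1] at h2
    linear_combination h2
  have hpar : Even p ↔ Even k := by
    rcases Nat.even_or_odd p with a | a <;> rcases Nat.even_or_odd k with b | b
    · exact ⟨fun _ => b, fun _ => a⟩
    · rw [a.neg_one_pow, b.neg_one_pow] at hneg; norm_num at hneg
    · rw [a.neg_one_pow, b.neg_one_pow] at hneg; norm_num at hneg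
    · exact ⟨fun c => absurd c (Nat.not_even_iff_odd.2 a), fun c => absurd c (Nat.not_even_iff_odd.2 b)⟩
  rcases lt_or_ge p k with hlt | hge
  · obtain ⟨q, rfl⟩ : ∃ q, k = p + 2 * q := by
      have : Even (k - p) := (Nat.even_sub hlt.le).2 hpar.symm
      obtain ⟨q, hq⟩ := this
      exact ⟨q, by omega⟩
    refine absurd ?_ (not_exists_eq_normSqC_pow_mul hn hh hω (q := q) (by omega) (by omega))
    refine ⟨fun y => (iteratedDeriv p f 0)⁻¹ * G y, contDiff_const.mul hG, fun y => ?_⟩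
    rcases eq_or_ne y 0 with rfl | hy
    · have := hom 0 0
      simpa [normSqC_zero, show q ≠ 0 by omega, show p + 2 * q ≠ 0 by omega] using this
    · have h1 := hGh y hy
      have hy' : (‖y‖ : ℂ) ≠ 0 := by simpa using hy
      have h2 : (‖y‖ : ℂ) ^ (2 * q) * G y = iteratedDeriv p f 0 * h y := by
        refine mul_left_cancel₀ (pow_ne_zero p hy') ?_
        linear_combination h1
      rw [normSqC, Complex.ofReal_pow, ← pow_mul]
      field_simp
      linear_combination -h2
  · obtain ⟨l, rfl⟩ : ∃ l, p = k + 2 * l := by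
      obtain ⟨q, hq⟩ := (Nat.even_sub hge).2 hpar
      exact ⟨q, by omega⟩
    refine ⟨l, ?_⟩
    simp only [hW_def, Complex.ofReal_zero] at hind
    push_cast at hind
    linear_combination (-1 / 2) * hind

/-- For `h ≠ 0` harmonic homogeneous of degree `k` on `ℝⁿ` (`n ≥ 2`), the radial
equation `ρ²ψ'' + (n-1+2k)ρψ' + (4s²ρ⁴ - 2ismρ² - 2λ)ψ = 0` has a not-identically-zero
C² solution on `(0,∞)` such that `y ↦ ψ(‖y‖)h(y)` extends smoothly to `ℝⁿ` iff
`λ = l(2l+2k+n-2)` for some integer `l ≥ 0`. -/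
theorem stmt17 (n k : ℕ) (hn : 2 ≤ n) (m : ℤ) (s lam : ℂ)
    (h : E n → ℂ) (hh : IsHarmonicHomog k h) (hne : h ≠ 0) :
    (∃ ψ : ℝ → ℂ, ContDiffOn ℝ 2 ψ (Set.Ioi 0) ∧ (∃ ρ : ℝ, 0 < ρ ∧ ψ ρ ≠ 0) ∧
        (∀ ρ : ℝ, 0 < ρ →
          ((ρ : ℝ) : ℂ) ^ 2 * deriv (deriv ψ) ρ
            + ((n : ℂ) - 1 + 2 * (k : ℂ)) * (ρ : ℂ) * deriv ψ ρ
            + (4 * s ^ 2 * ((ρ : ℝ) : ℂ) ^ 4 - 2 * Complex.I * s * (m : ℂ) * ((ρ : ℝ) : ℂ) ^ 2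
                - 2 * lam) * ψ ρ = 0) ∧
        (∃ g : E n → ℂ, ContDiff ℝ (⊤ : ℕ∞) g ∧ ∀ y : E n, y ≠ 0 → g y = ψ ‖y‖ * h y)) ↔
      (∃ l : ℤ, 0 ≤ l ∧ lam = (l : ℂ) * (2 * (l : ℂ) + 2 * (k : ℂ) + (n : ℂ) - 2)) := by
  constructor
  · rintro ⟨ψ, hψ, hψ0, hode, g, hg, hgψ⟩
    obtain ⟨l, hl⟩ := eigenvalue_of_radial_solution hn hh hne hψ hψ0 hode hg hgψ
    exact ⟨l, by positivity, by exact_mod_cast hl⟩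
  · rintro ⟨l, hl, hlam⟩
    lift l to ℕ using hl
    exact exists_radial_solution n k l hn s m lam (by exact_mod_cast hlam) hh.contDiff

end
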